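/- arXiv:1307.1800 — 2 statements merged into one kernel-verified Lean document; each statement's English description precedes it below -/
import Mathlib

section
/- For d ≥ 3, 1 ≤ r < d/2, the generating functions satisfy 𝒞_{d,r}(q) = ℬ_{d,r}(q) · g₃(-q^r; q^d) for |q| < 1, i.e., the universal mock theta function g₃(-q^r; q^d) is the quotient of the Schur-type generating function with smallest part > d by the one with no smallest-part restriction. -/
open scoped BigOperators

/-- The finite q-Pochhammer symbol `(a; q)_n`. -/
noncomputable def qPoch (a q : ℂ) (n : ℕ) : ℂ := ∏ j ∈ Finset.range n, (1 - a * q ^ j)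

/-- Hickerson's universal mock theta function
`g₃(x;q) = Σ_{n≥0} q^{n(n+1)} / ((x;q)_{n+1} (x⁻¹q;q)_{n+1})`. -/
noncomputable def g3 (x q : ℂ) : ℂ :=
  ∑' n : ℕ, q ^ (n * (n + 1)) / (qPoch x q (n + 1) * qPoch (x⁻¹ * q) q (n + 1))

/-- A Schur-type partition for parameters `d, r`. -/
def IsSchurPartition (d r : ℕ) (l : List ℕ) : Prop :=
  (∀ x ∈ l, 0 < x ∧ (x % d = 0 ∨ x % d = r ∨ x % d = d - r)) ∧
    l.Chain' (fun a b => b + d ≤ a ∧ (d ∣ a → b + d < a))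

/-- `B_{d,r}(n)`: the number of Schur-type partitions of `n`. -/
noncomputable def schurB (d r n : ℕ) : ℕ :=
  Set.ncard {l : List ℕ | IsSchurPartition d r l ∧ l.sum = n}

/-- `C_{d,r}(n)`: the number of Schur-type partitions of `n` with smallest part `> d`. -/
noncomputable def schurC (d r n : ℕ) : ℕ :=
  Set.ncard {l : List ℕ | IsSchurPartition d r l ∧ (∀ x ∈ l, d < x) ∧ l.sum = n}

/-- The generating function `ℬ_{d,r}(q) = Σ_{n≥0} B_{d,r}(n) q^n`. -/
noncomputable def schurBGen (d r : ℕ) (q : ℂ) : ℂ := ∑' n : ℕ, (schurB d r n : ℂ) * q ^ n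

/-- The generating function `𝒞_{d,r}(q) = Σ_{n≥0} C_{d,r}(n) q^n`. -/
noncomputable def schurCGen (d r : ℕ) (q : ℂ) : ℂ := ∑' n : ℕ, (schurC d r n : ℂ) * q ^ n

open Filter Topology

lemma qPoch_zero (a q : ℂ) : qPoch a q 0 = 1 := by simp [qPoch]

lemma qPoch_succ (a q : ℂ) (n : ℕ) : qPoch a q (n + 1) = qPoch a q n * (1 - a * q ^ n) :=
  Finset.prod_range_succ _ _

lemma qPoch_succ' (a q : ℂ) (n : ℕ) : qPoch a q (n + 1) = (1 - a) * qPoch (a * q) q n := by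
  rw [qPoch, Finset.prod_range_succ', qPoch, mul_comm]
  simp [pow_succ', mul_assoc]

lemma norm_mul_pow_lt_one {a q : ℂ} (ha : ‖a‖ < 1) (hq : ‖q‖ < 1) (n : ℕ) : ‖a * q ^ n‖ < 1 := by
  rw [norm_mul, norm_pow]
  exact mul_lt_one_of_nonneg_of_lt_one_left (norm_nonneg _) ha
    (pow_le_one₀ (norm_nonneg _) hq.le)

lemma one_sub_ne_zero_of_norm_lt_one {z : ℂ} (hz : ‖z‖ < 1) : 1 - z ≠ 0 := by
  intro h
  rw [← sub_eq_zero.mp h] at hz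
  simp at hz

lemma one_sub_mul_pow_ne_zero {a q : ℂ} (ha : ‖a‖ < 1) (hq : ‖q‖ < 1) (n : ℕ) :
    1 - a * q ^ n ≠ 0 :=
  one_sub_ne_zero_of_norm_lt_one (norm_mul_pow_lt_one ha hq n)

lemma qPoch_ne_zero {a q : ℂ} (ha : ‖a‖ < 1) (hq : ‖q‖ < 1) (n : ℕ) : qPoch a q n ≠ 0 :=
  Finset.prod_ne_zero_iff.mpr fun j _ => one_sub_mul_pow_ne_zero ha hq j

/-- The reciprocals of the finite `q`-Pochhammer symbols `(a; q)_n` are uniformly bounded. -/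
lemma exists_norm_inv_qPoch_le {a q : ℂ} (ha : ‖a‖ < 1) (hq : ‖q‖ < 1) :
    ∃ M, 0 ≤ M ∧ ∀ n, ‖(qPoch a q n)⁻¹‖ ≤ M := by
  have hs : Summable fun n : ℕ => ‖-(a * q ^ n)‖ := by
    simpa [norm_mul, norm_pow] using (summable_geometric_of_lt_one (norm_nonneg q) hq).mul_left ‖a‖
  have hne : ∏' n : ℕ, (1 + -(a * q ^ n)) ≠ 0 := by
    refine tprod_one_add_ne_zero_of_summable (fun n => ?_) hs
    rw [← sub_eq_add_neg]
    exact one_sub_mul_pow_ne_zero ha hq n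
  have ht := ((multipliable_one_add_of_summable hs).hasProd.tendsto_prod_nat.inv₀ hne).norm
  obtain ⟨M, hM⟩ := ht.bddAbove_range
  have hM' : ∀ n, ‖(qPoch a q n)⁻¹‖ ≤ M := fun n => by
    simpa [qPoch, sub_eq_add_neg] using hM (Set.mem_range_self n)
  exact ⟨M, (norm_nonneg _).trans (hM' 0), hM'⟩

/-- The symbols `(a; q)_n` are bounded uniformly in `n` and in `‖a‖ ≤ 1`. -/
lemma exists_norm_qPoch_le {q : ℂ} (hq : ‖q‖ < 1) :
    ∃ M, 0 ≤ M ∧ ∀ a : ℂ, ‖a‖ ≤ 1 → ∀ n, ‖qPoch a q n‖ ≤ M := by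
  have hs : Summable fun n : ℕ => ‖q‖ ^ n := summable_geometric_of_lt_one (norm_nonneg q) hq
  obtain ⟨M, hM⟩ :=
    (Real.multipliable_one_add_of_summable hs).hasProd.tendsto_prod_nat.bddAbove_range
  have hM' : ∀ a : ℂ, ‖a‖ ≤ 1 → ∀ n, ‖qPoch a q n‖ ≤ M := fun a ha n => by
    refine le_trans ?_ (hM (Set.mem_range_self n))
    rw [qPoch, norm_prod]
    refine Finset.prod_le_prod (fun _ _ => norm_nonneg _) fun j _ => ?_
    refine (norm_sub_le _ _).trans ?_
    rw [norm_one, norm_mul, norm_pow]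
    gcongr
    exact mul_le_of_le_one_left (by positivity) ha
  exact ⟨M, (norm_nonneg _).trans (hM' 0 (by simp) 0), hM'⟩

/-- The bounded solutions of a three-term recurrence with `e k → 0` are proportional. -/
lemma mul_eq_mul_of_bounded_of_recurrence {F W c e : ℕ → ℂ} {A B : ℝ}
    (hF : ∀ k, F k = c k * F (k + 1) + e k * F (k + 2))
    (hW : ∀ k, W k = c k * W (k + 1) + e k * W (k + 2))
    (he : Tendsto e atTop (𝓝 0)) (hFA : ∀ k, ‖F k‖ ≤ A) (hWB : ∀ k, ‖W k‖ ≤ B) :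
    F 0 * W 1 = F 1 * W 0 := by
  set C : ℕ → ℂ := fun k => F k * W (k + 1) - F (k + 1) * W k with hC
  have hrec : ∀ k, C k = -e k * C (k + 1) := fun k => by
    simp only [hC]
    rw [hF k, hW k]
    ring
  have hA : 0 ≤ A := (norm_nonneg _).trans (hFA 0)
  have hbd : ∀ k, ‖C k‖ ≤ 2 * (A * B) := fun k => by
    refine (norm_sub_le _ _).trans ?_
    rw [norm_mul, norm_mul, two_mul]
    gcongr <;> apply_assumption
  obtain ⟨k₀, hk₀⟩ := Metric.tendsto_atTop.mp he (1 / 2) (by norm_num)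
  have hsmall : ∀ m k, k₀ ≤ k → ‖C k‖ ≤ (1 / 2) ^ m * (2 * (A * B)) := by
    intro m
    induction m with
    | zero => intro k _; simpa using hbd k
    | succ m ih =>
      intro k hk
      have h1 : ‖e k‖ ≤ 1 / 2 := by simpa using (hk₀ k hk).le
      rw [hrec, norm_mul, norm_neg, pow_succ', mul_assoc]
      exact mul_le_mul h1 (ih _ (by omega)) (norm_nonneg _) (by norm_num)
  have hlim : Tendsto (fun m : ℕ => (1 / 2 : ℝ) ^ m * (2 * (A * B))) atTop (𝓝 0) := by
    simpa using (tendsto_pow_atTop_nhds_zero_of_lt_one (by norm_num : (0 : ℝ) ≤ 1 / 2)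
      (by norm_num)).mul_const (2 * (A * B))
  have hzero : C k₀ = 0 := norm_le_zero_iff.mp (ge_of_tendsto' hlim fun m => hsmall m k₀ le_rfl)
  have hback : ∀ k, C k = 0 → C 0 = 0 := by
    intro k
    induction k with
    | zero => exact id
    | succ k ih => intro h; exact ih (by rw [hrec, h, mul_zero])
  exact sub_eq_zero.mp (hback k₀ hzero)

/-- A bounded coefficient sequence times a geometric one is summable. -/
lemma summable_mul_pow_of_norm_le {u : ℕ → ℂ} {b : ℂ} {M : ℝ} (hb : ‖b‖ < 1)
    (hu : ∀ n, ‖u n‖ ≤ M) : Summable fun n => u n * b ^ n := by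
  refine Summable.of_norm_bounded ((summable_geometric_of_lt_one (norm_nonneg b) hb).mul_left M)
    fun n => ?_
  rw [norm_mul, norm_pow]
  gcongr
  exact hu n

lemma norm_tsum_mul_pow_le {u : ℕ → ℂ} {b : ℂ} {M : ℝ} (hb : ‖b‖ < 1) (hu : ∀ n, ‖u n‖ ≤ M) :
    ‖∑' n, u n * b ^ n‖ ≤ M * (1 - ‖b‖)⁻¹ := by
  refine tsum_of_norm_bounded ((hasSum_geometric_of_lt_one (norm_nonneg b) hb).mul_left M)
    fun n => ?_
  rw [norm_mul, norm_pow]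
  gcongr
  exact hu n

/-- The coefficients of the series `heineSeries`. -/
noncomputable def heineCoeff (a q : ℂ) (k n : ℕ) : ℂ :=
  qPoch (q ^ k) q n / (qPoch q q n * qPoch a q (n + k))

/-- The series `Σ_{n≥0} (q^k; q)_n / ((q; q)_n (a; q)_{n+k}) b^n`. -/
noncomputable def heineSeries (a b q : ℂ) (k : ℕ) : ℂ := ∑' n, heineCoeff a q k n * b ^ n

lemma exists_norm_heineCoeff_le {a q : ℂ} (ha : ‖a‖ < 1) (hq : ‖q‖ < 1) :
    ∃ M, 0 ≤ M ∧ ∀ k n, ‖heineCoeff a q k n‖ ≤ M := by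
  obtain ⟨M₁, h₁, hM₁⟩ := exists_norm_qPoch_le hq
  obtain ⟨M₂, h₂, hM₂⟩ := exists_norm_inv_qPoch_le hq hq
  obtain ⟨M₃, h₃, hM₃⟩ := exists_norm_inv_qPoch_le ha hq
  refine ⟨M₁ * (M₂ * M₃), by positivity, fun k n => ?_⟩
  rw [heineCoeff, div_eq_mul_inv, mul_inv, norm_mul, norm_mul]
  have hk : ‖q ^ k‖ ≤ 1 := by
    rw [norm_pow]
    exact pow_le_one₀ (norm_nonneg _) hq.le
  gcongr
  · exact hM₁ _ hk _
  · exact hM₂ _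
  · exact hM₃ _

lemma heineSeries_zero (a b q : ℂ) : heineSeries a b q 0 = 1 := by
  rw [heineSeries, tsum_eq_single 0]
  · simp [heineCoeff, qPoch_zero]
  · intro n hn
    obtain ⟨m, rfl⟩ := Nat.exists_eq_succ_of_ne_zero hn
    simp [heineCoeff, qPoch_succ']

lemma heineSeries_one {a b q : ℂ} (hq : ‖q‖ < 1) :
    heineSeries a b q 1 = ∑' n, (qPoch a q (n + 1))⁻¹ * b ^ n := by
  refine tsum_congr fun n => ?_
  have := qPoch_ne_zero hq hq n
  rw [heineCoeff, pow_one]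
  field_simp

/-- Telescoping certificate for the three-term recurrence of `heineSeries`. -/
lemma sum_heineCoeff_recurrence {a b q : ℂ} (ha : ‖a‖ < 1) (hq : ‖q‖ < 1) (hab : a * b = q)
    (k N : ℕ) :
    ∑ n ∈ Finset.range (N + 1), (heineCoeff a q k n * b ^ n -
      (1 - q ^ k * (a + b)) * (heineCoeff a q (k + 1) n * b ^ n) -
      q ^ (k + 1) * (1 - q ^ (k + 1)) * (heineCoeff a q (k + 2) n * b ^ n)) =
    q ^ k * (1 - a) * b / (1 - a * q ^ (N + k + 1)) * (heineCoeff a q (k + 1) N * b ^ N) := by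
  induction N with
  | zero =>
    have h1 := qPoch_ne_zero ha hq k
    have h2 := one_sub_mul_pow_ne_zero ha hq k
    have h3 := one_sub_mul_pow_ne_zero ha hq (k + 1)
    have h4 : 1 - q ^ k * a ≠ 0 := by rwa [mul_comm]
    simp only [zero_add, Finset.sum_range_one, heineCoeff, qPoch_zero, qPoch_succ, pow_zero]
    field_simp
    rw [← hab]
    ring
  | succ N ih =>
    rw [Finset.sum_range_succ, ih]
    have hz : qPoch (q ^ k) q (N + 1) = (1 - q ^ k) * qPoch (q ^ (k + 1)) q N := by
      rw [qPoch_succ', pow_succ]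
    have hz2 : (1 - q ^ (k + 1)) * qPoch (q ^ (k + 2)) q (N + 1) =
        qPoch (q ^ (k + 1)) q N * (1 - q ^ (k + 1) * q ^ N) *
          (1 - q ^ (k + 1) * q ^ (N + 1)) := by
      rw [← qPoch_succ, ← qPoch_succ, qPoch_succ' (q ^ (k + 1)), ← pow_succ]
    have h1 := qPoch_ne_zero ha hq (N + k + 1)
    have h2 := one_sub_mul_pow_ne_zero ha hq (N + k + 1)
    have h3 := one_sub_mul_pow_ne_zero ha hq (N + k + 2)
    have h4 := qPoch_ne_zero hq hq N
    have h5 := one_sub_mul_pow_ne_zero hq hq N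
    have e1 : N + 1 + k = N + k + 1 := by ring
    have e2 : N + 1 + (k + 1) = N + k + 1 + 1 := by ring
    have e3 : N + 1 + (k + 2) = N + k + 1 + 1 + 1 := by ring
    have e4 : N + (k + 1) = N + k + 1 := by ring
    have e5 : N + k + 1 + 1 = N + k + 2 := by ring
    have key : q ^ (k + 1) * (1 - q ^ (k + 1)) * (heineCoeff a q (k + 2) (N + 1) * b ^ (N + 1)) =
        q ^ (k + 1) * (qPoch (q ^ (k + 1)) q N * (1 - q ^ (k + 1) * q ^ N) *
          (1 - q ^ (k + 1) * q ^ (N + 1))) / (qPoch q q (N + 1) *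
            qPoch a q (N + 1 + (k + 2))) * b ^ (N + 1) := by
      rw [heineCoeff, ← hz2]
      ring
    rw [key]
    simp only [heineCoeff, e1, e2, e3, e4, hz, qPoch_succ _ _ (N + k + 1),
      qPoch_succ _ _ (N + k + 1 + 1), qPoch_succ _ _ N, e5]
    field_simp
    rw [← hab]
    ring

lemma heineSeries_recurrence {a b q : ℂ} (ha : ‖a‖ < 1) (hb : ‖b‖ < 1) (hq : ‖q‖ < 1)
    (hab : a * b = q) (k : ℕ) :
    heineSeries a b q k = (1 - q ^ k * (a + b)) * heineSeries a b q (k + 1) +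
      q ^ (k + 1) * (1 - q ^ (k + 1)) * heineSeries a b q (k + 2) := by
  obtain ⟨M, -, hM⟩ := exists_norm_heineCoeff_le ha hq
  have hs : ∀ k, HasSum (fun n => heineCoeff a q k n * b ^ n) (heineSeries a b q k) :=
    fun k => (summable_mul_pow_of_norm_le hb (hM k)).hasSum
  have hsum := ((hs k).sub ((hs (k + 1)).mul_left (1 - q ^ k * (a + b)))).sub
    ((hs (k + 2)).mul_left (q ^ (k + 1) * (1 - q ^ (k + 1))))
  have ht := hsum.tendsto_sum_nat.comp (tendsto_add_atTop_nat 1)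
  have hlim : Tendsto (fun N : ℕ => q ^ k * (1 - a) * b / (1 - a * q ^ (N + k + 1)) *
      (heineCoeff a q (k + 1) N * b ^ N)) atTop (𝓝 0) := by
    have hpow : Tendsto (fun N : ℕ => q ^ (N + (k + 1))) atTop (𝓝 0) :=
      (tendsto_pow_atTop_nhds_zero_of_norm_lt_one hq).comp (tendsto_add_atTop_nat (k + 1))
    have hden : Tendsto (fun N : ℕ => 1 - a * q ^ (N + (k + 1))) atTop (𝓝 1) := by
      simpa using (hpow.const_mul a).const_sub 1
    simpa [add_assoc] using ((tendsto_const_nhds (x := q ^ k * (1 - a) * b)).div hden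
      one_ne_zero).mul (hs (k + 1)).summable.tendsto_atTop_zero
  have := tendsto_nhds_unique (ht.congr fun N => sum_heineCoeff_recurrence ha hq hab k N) hlim
  linear_combination this

/-- The Rogers–Fine type remainder series `Σ_{n≥0} (b q^N)^n / (a; q)_{N+n+1}`. -/
noncomputable def fineTail (a b q : ℂ) (N : ℕ) : ℂ :=
  ∑' n, (qPoch a q (N + n + 1))⁻¹ * (b * q ^ N) ^ n

lemma fineTail_recurrence {a b q : ℂ} (ha : ‖a‖ < 1) (hb : ‖b‖ < 1) (hq : ‖q‖ < 1)
    (hab : a * b = q) (N : ℕ) :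
    (1 - b * q ^ N) * fineTail a b q N =
      (qPoch a q (N + 1))⁻¹ + q ^ (2 * N + 2) * fineTail a b q (N + 1) := by
  obtain ⟨M, -, hM⟩ := exists_norm_inv_qPoch_le ha hq
  have hs : ∀ N, Summable fun n => (qPoch a q (N + n + 1))⁻¹ * (b * q ^ N) ^ n := fun N =>
    summable_mul_pow_of_norm_le (norm_mul_pow_lt_one hb hq N) fun n => hM (N + n + 1)
  have h1 : fineTail a b q N = (qPoch a q (N + 1))⁻¹ +
      ∑' n, (qPoch a q (N + (n + 1) + 1))⁻¹ * (b * q ^ N) ^ (n + 1) := by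
    rw [fineTail, (hs N).tsum_eq_zero_add]
    simp
  have h2 : ∑' n, (qPoch a q (N + (n + 1) + 1))⁻¹ * (b * q ^ N) ^ (n + 1) =
      b * q ^ N * fineTail a b q N + q ^ (2 * N + 2) * fineTail a b q (N + 1) := by
    rw [fineTail, fineTail, ← tsum_mul_left, ← tsum_mul_left,
      ← ((hs N).mul_left _).tsum_add ((hs (N + 1)).mul_left _)]
    refine tsum_congr fun n => ?_
    have e1 : N + (n + 1) + 1 = N + n + 1 + 1 := by ring
    have e2 : N + 1 + n + 1 = N + n + 1 + 1 := by ring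
    have h3 := qPoch_ne_zero ha hq (N + n + 1)
    have h4 := one_sub_mul_pow_ne_zero ha hq (N + n + 1)
    rw [e1, e2, qPoch_succ a q (N + n + 1)]
    field_simp
    have : q ^ (2 * N + 2) = a * b * q ^ (2 * N + 1) := by rw [hab]; ring
    rw [this]
    ring
  linear_combination h1 + h2

lemma fineTail_zero_eq_sum_add {a b q : ℂ} (ha : ‖a‖ < 1) (hb : ‖b‖ < 1) (hq : ‖q‖ < 1)
    (hab : a * b = q) (N : ℕ) :
    fineTail a b q 0 =
      ∑ n ∈ Finset.range N, q ^ (n * (n + 1)) / (qPoch a q (n + 1) * qPoch b q (n + 1)) +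
        q ^ (N * (N + 1)) * (qPoch b q N)⁻¹ * fineTail a b q N := by
  induction N with
  | zero => simp [qPoch_zero]
  | succ N ih =>
    rw [ih, Finset.sum_range_succ, add_assoc]
    congr 1
    have h1 := qPoch_ne_zero ha hq (N + 1)
    have h2 := qPoch_ne_zero hb hq N
    have h3 := one_sub_mul_pow_ne_zero hb hq N
    have h4 : fineTail a b q N = ((qPoch a q (N + 1))⁻¹ +
        q ^ (2 * N + 2) * fineTail a b q (N + 1)) / (1 - b * q ^ N) := by
      rw [← fineTail_recurrence ha hb hq hab N, mul_div_cancel_left₀ _ h3]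
    rw [h4, qPoch_succ b]
    field_simp
    ring

/-- A special case of the Rogers–Fine identity. -/
lemma tsum_eq_tsum_rogersFine {a b q : ℂ} (ha : ‖a‖ < 1) (hb : ‖b‖ < 1) (hq : ‖q‖ < 1)
    (hab : a * b = q) :
    ∑' n, (qPoch a q (n + 1))⁻¹ * b ^ n =
      ∑' n : ℕ, q ^ (n * (n + 1)) / (qPoch a q (n + 1) * qPoch b q (n + 1)) := by
  obtain ⟨A, hA, hMa⟩ := exists_norm_inv_qPoch_le ha hq
  obtain ⟨B, hB, hMb⟩ := exists_norm_inv_qPoch_le hb hq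
  have hpow : ∀ n : ℕ, ‖q ^ (n * (n + 1))‖ ≤ ‖q‖ ^ n := fun n => by
    rw [norm_pow]
    exact pow_le_pow_of_le_one (norm_nonneg _) hq.le (Nat.le_mul_of_pos_right _ n.succ_pos)
  have hgeom := summable_geometric_of_lt_one (norm_nonneg q) hq
  have hs : Summable fun n : ℕ =>
      q ^ (n * (n + 1)) / (qPoch a q (n + 1) * qPoch b q (n + 1)) := by
    refine Summable.of_norm_bounded (hgeom.mul_right (A * B)) fun n => ?_
    rw [div_eq_mul_inv, mul_inv, norm_mul, norm_mul]
    gcongr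
    · exact hpow n
    · exact hMa _
    · exact hMb _
  have htail : ∀ N, ‖fineTail a b q N‖ ≤ A * (1 - ‖b‖)⁻¹ := fun N => by
    have hbN : ‖b * q ^ N‖ ≤ ‖b‖ := by
      rw [norm_mul, norm_pow]
      exact mul_le_of_le_one_right (norm_nonneg _) (pow_le_one₀ (norm_nonneg _) hq.le)
    refine (norm_tsum_mul_pow_le (norm_mul_pow_lt_one hb hq N)
      fun n => hMa (N + n + 1)).trans ?_
    have : 0 < 1 - ‖b‖ := by linarith
    gcongr
  have hrem : Tendsto (fun N : ℕ => q ^ (N * (N + 1)) * (qPoch b q N)⁻¹ * fineTail a b q N)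
      atTop (𝓝 0) := by
    refine squeeze_zero_norm (a := fun N => ‖q‖ ^ N * B * (A * (1 - ‖b‖)⁻¹)) (fun N => ?_) ?_
    · rw [norm_mul, norm_mul]
      gcongr
      · exact hpow N
      · exact hMb N
      · exact htail N
    · simpa [mul_assoc] using hgeom.tendsto_atTop_zero.mul_const (B * (A * (1 - ‖b‖)⁻¹))
  have hlim := hs.hasSum.tendsto_sum_nat.add hrem
  rw [add_zero] at hlim
  have hconst := hlim.congr fun N => (fineTail_zero_eq_sum_add ha hb hq hab N).symm
  rw [← tendsto_nhds_unique tendsto_const_nhds hconst, fineTail]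
  simp
/-- The gap condition satisfied by consecutive parts `a`, `b` of a Schur-type partition. -/
def SchurGap (d a b : ℕ) : Prop := b + d ≤ a ∧ (d ∣ a → b + d < a)

instance (d : ℕ) : Trans (SchurGap d) (SchurGap d) (SchurGap d) where
  trans {a b c} h₁ h₂ := by
    simp only [SchurGap] at *
    exact ⟨by omega, fun h => by have := h₁.2 h; omega⟩

/-- The residues modulo `d` allowed for the parts of a Schur-type partition. -/
def IsSchurPart (d r x : ℕ) : Prop := x % d = 0 ∨ x % d = r ∨ x % d = d - r

/-- The Schur-type partitions all of whose parts exceed `m`. -/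
def schurAbove (d r m : ℕ) : Set (List ℕ) := {l | IsSchurPartition d r l ∧ ∀ x ∈ l, m < x}

lemma mem_schurAbove {d r m : ℕ} {l : List ℕ} : l ∈ schurAbove d r m ↔
    (∀ x ∈ l, IsSchurPart d r x ∧ m < x) ∧ l.Pairwise (SchurGap d) := by
  have h : IsSchurPartition d r l ↔
      (∀ x ∈ l, 0 < x ∧ IsSchurPart d r x) ∧ l.IsChain (SchurGap d) := Iff.rfl
  rw [schurAbove, Set.mem_ofPred_eq, h, List.isChain_iff_pairwise]
  constructor
  · exact fun ⟨⟨h₁, h₂⟩, h₃⟩ => ⟨fun x hx => ⟨(h₁ x hx).2, h₃ x hx⟩, h₂⟩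
  · exact fun ⟨h₁, h₂⟩ =>
      ⟨⟨fun x hx => ⟨pos_of_gt (h₁ x hx).2, (h₁ x hx).1⟩, h₂⟩, fun x hx => (h₁ x hx).2⟩

lemma schurAbove_succ_of_not {d r m : ℕ} (h : ¬ IsSchurPart d r (m + 1)) :
    schurAbove d r m = schurAbove d r (m + 1) := by
  ext l
  simp only [mem_schurAbove]
  refine and_congr_left fun _ => forall₂_congr fun x _ => and_congr_right fun hx => ?_
  refine ⟨fun hm => lt_of_le_of_ne hm ?_, fun hm => by omega⟩
  rintro rfl
  exact h hx

lemma schurAbove_eq_of_forall_not {d r m n : ℕ} (hmn : m ≤ n)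
    (h : ∀ x, m < x → x ≤ n → ¬ IsSchurPart d r x) : schurAbove d r m = schurAbove d r n := by
  induction n, hmn using Nat.le_induction with
  | base => rfl
  | succ n hn ih =>
    rw [ih fun x h₁ h₂ => h x h₁ (by omega), schurAbove_succ_of_not (h (n + 1) (by omega) le_rfl)]

/-- Splitting off the smallest part `m + 1`; the remaining parts exceed `m'`. -/
lemma schurAbove_eq_union {d r m m' : ℕ} (hp : IsSchurPart d r (m + 1))
    (hgap : ∀ a, IsSchurPart d r a → (SchurGap d a (m + 1) ↔ m' < a)) :
    schurAbove d r m = schurAbove d r (m + 1) ∪ (· ++ [m + 1]) '' schurAbove d r m' := by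
  ext l
  simp only [Set.mem_union, Set.mem_image, mem_schurAbove]
  constructor
  · rintro ⟨h₁, h₂⟩
    rcases List.eq_nil_or_concat' l with rfl | ⟨l, x, rfl⟩
    · simp
    · rw [List.pairwise_append] at h₂
      rcases eq_or_ne x (m + 1) with rfl | hx
      · refine Or.inr ⟨l, ⟨fun a ha => ?_, h₂.1⟩, rfl⟩
        have ha' := (h₁ a (by simp [ha])).1
        exact ⟨ha', (hgap a ha').mp (h₂.2.2 a ha _ (by simp))⟩
      · have hmx := (h₁ x (by simp)).2
        refine Or.inl ⟨fun a ha => ⟨(h₁ a ha).1, ?_⟩, List.pairwise_append.mpr h₂⟩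
        rcases List.mem_append.mp ha with ha | ha
        · have := (h₂.2.2 a ha x (by simp)).1
          omega
        · rw [List.mem_singleton.mp ha]
          omega
  · rintro (⟨h₁, h₂⟩ | ⟨l, ⟨h₁, h₂⟩, rfl⟩)
    · exact ⟨fun x hx => ⟨(h₁ x hx).1, by have := (h₁ x hx).2; omega⟩, h₂⟩
    · have hg : ∀ a ∈ l, SchurGap d a (m + 1) := fun a ha =>
        (hgap a (h₁ a ha).1).mpr (h₁ a ha).2
      refine ⟨fun x hx => ?_, List.pairwise_append.mpr ⟨h₂, by simp, by simpa using hg⟩⟩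
      rcases List.mem_append.mp hx with hx | hx
      · have := (hg x hx).1
        exact ⟨(h₁ x hx).1, by omega⟩
      · rw [List.mem_singleton.mp hx]
        exact ⟨hp, by omega⟩

lemma summable_pow_sum_of_pairwise_gt {q : ℂ} (hq : ‖q‖ < 1) :
    Summable fun l : {l : List ℕ | l.Pairwise (· > ·)} => ‖q ^ (l : List ℕ).sum‖ := by
  have hs := summable_finsetProd_of_summable_nonneg (fun n => pow_nonneg (norm_nonneg q) n)
    (summable_geometric_of_lt_one (norm_nonneg q) hq)
  have hnodup : ∀ l : {l : List ℕ | l.Pairwise (· > ·)}, (l : List ℕ).Nodup := fun l =>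
    List.Pairwise.imp (fun h => h.ne') l.2
  have hinj : Function.Injective
      fun l : {l : List ℕ | l.Pairwise (· > ·)} => (l : List ℕ).toFinset := fun l₁ l₂ h =>
    Subtype.ext <| (List.perm_of_nodup_nodup_toFinset_eq (hnodup l₁) (hnodup l₂) h).eq_of_pairwise
      (fun a b _ _ h₁ h₂ => absurd h₁ (lt_asymm h₂)) l₁.2 l₂.2
  refine (hs.comp_injective hinj).congr fun l => ?_
  rw [Function.comp_apply, Finset.prod_pow_eq_pow_sum, norm_pow,
    List.sum_toFinset _ (hnodup l), List.map_id']

lemma schurAbove_subset {d : ℕ} (hd : 0 < d) (r m : ℕ) :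
    schurAbove d r m ⊆ {l : List ℕ | l.Pairwise (· > ·)} := fun l hl =>
  (mem_schurAbove.mp hl).2.imp fun h => by
    have := h.1
    omega

/-- The generating function of the Schur-type partitions all of whose parts exceed `m`. -/
noncomputable def schurAboveGen (d r m : ℕ) (q : ℂ) : ℂ :=
  ∑' l : schurAbove d r m, q ^ (l : List ℕ).sum

lemma summable_norm_schurAbove {d : ℕ} (hd : 0 < d) (r m : ℕ) {q : ℂ} (hq : ‖q‖ < 1) :
    Summable fun l : schurAbove d r m => ‖q ^ (l : List ℕ).sum‖ := by
  have h := (summable_pow_sum_of_pairwise_gt hq).comp_injective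
    (Set.inclusion_injective (schurAbove_subset hd r m))
  simpa only [Function.comp_def, Set.coe_inclusion] using h

lemma exists_norm_schurAboveGen_le {d : ℕ} (hd : 0 < d) (r : ℕ) {q : ℂ} (hq : ‖q‖ < 1) :
    ∃ M, ∀ m, ‖schurAboveGen d r m q‖ ≤ M := by
  refine ⟨∑' l : {l : List ℕ | l.Pairwise (· > ·)}, ‖q ^ (l : List ℕ).sum‖, fun m =>
    (norm_tsum_le_tsum_norm (summable_norm_schurAbove hd r m hq)).trans ?_⟩
  refine (summable_norm_schurAbove hd r m hq).tsum_le_tsum_of_inj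
    (Set.inclusion (schurAbove_subset hd r m)) (Set.inclusion_injective _)
    (fun _ _ => norm_nonneg _) (fun l => ?_) (summable_pow_sum_of_pairwise_gt hq)
  rw [Set.coe_inclusion (schurAbove_subset hd r m)]

lemma schurAboveGen_eq_add {d r m m' : ℕ} (hd : 0 < d) {q : ℂ} (hq : ‖q‖ < 1)
    (hp : IsSchurPart d r (m + 1))
    (hgap : ∀ a, IsSchurPart d r a → (SchurGap d a (m + 1) ↔ m' < a)) :
    schurAboveGen d r m q =
      schurAboveGen d r (m + 1) q + q ^ (m + 1) * schurAboveGen d r m' q := by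
  have hunion := schurAbove_eq_union hp hgap
  have hsum : ∀ n, Summable fun l : schurAbove d r n => q ^ (l : List ℕ).sum :=
    fun n => (summable_norm_schurAbove hd r n hq).of_norm
  have hinj : Set.InjOn (· ++ [m + 1]) (schurAbove d r m') :=
    (List.append_left_injective [m + 1]).injOn
  have hsub : (· ++ [m + 1]) '' schurAbove d r m' ⊆ schurAbove d r m := by
    rw [hunion]
    exact Set.subset_union_right
  have himage : Summable fun l : (· ++ [m + 1]) '' schurAbove d r m' => q ^ (l : List ℕ).sum := by
    have h := (hsum m).comp_injective (Set.inclusion_injective hsub)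
    simpa only [Function.comp_def, Set.coe_inclusion] using h
  have hdisj : Disjoint (schurAbove d r (m + 1)) ((· ++ [m + 1]) '' schurAbove d r m') := by
    rw [Set.disjoint_left]
    rintro _ h ⟨l, -, rfl⟩
    exact absurd (h.2 (m + 1) (by simp)) (lt_irrefl _)
  rw [schurAboveGen, hunion, Summable.tsum_union_disjoint (f := fun l : List ℕ => q ^ l.sum)
    hdisj (hsum (m + 1)) himage,
    tsum_image (fun l : List ℕ => q ^ l.sum) hinj, schurAboveGen, schurAboveGen, ← tsum_mul_left]
  simp [pow_add, mul_comm]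

lemma schurAboveGen_eq_of_forall_not {d r m n : ℕ} (q : ℂ) (hmn : m ≤ n)
    (h : ∀ x, m < x → x ≤ n → ¬ IsSchurPart d r x) :
    schurAboveGen d r m q = schurAboveGen d r n q := by
  rw [schurAboveGen, schurAboveGen, schurAbove_eq_of_forall_not hmn h]

lemma tsum_ncard_mul_pow {s : Set (List ℕ)} {q : ℂ}
    (hs : Summable fun l : s => q ^ (l : List ℕ).sum) :
    ∑' n : ℕ, (Set.ncard {l | l ∈ s ∧ l.sum = n} : ℂ) * q ^ n =
      ∑' l : s, q ^ (l : List ℕ).sum := by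
  have h := hs.hasSum.tsum_fiberwise fun l : s => (l : List ℕ).sum
  rw [← h.tsum_eq]
  refine tsum_congr fun n => ?_
  have hcard : Set.ncard {l | l ∈ s ∧ l.sum = n} =
      Nat.card ((fun l : s => (l : List ℕ).sum) ⁻¹' {n}) := by
    rw [Nat.card_coe_set_eq, ← Set.ncard_image_of_injective _ Subtype.val_injective]
    congr 1
    ext l
    simp [and_comm]
  rw [hcard, ← nsmul_eq_mul, ← tsum_const]
  exact tsum_congr fun l => by rw [show (l : s).1.sum = n from l.2]

lemma isSchurPart_mul_add_iff {d r k s : ℕ} (hs : s < d) :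
    IsSchurPart d r (d * k + s) ↔ s = 0 ∨ s = r ∨ s = d - r := by
  rw [IsSchurPart, Nat.mul_add_mod, Nat.mod_eq_of_lt hs]

/-- The three-term recurrence for the generating functions with smallest part `> d k`. -/
lemma schurAboveGen_recurrence {d r : ℕ} (hr1 : 1 ≤ r) (hr2 : 2 * r < d) {q : ℂ}
    (hq : ‖q‖ < 1) (k : ℕ) :
    schurAboveGen d r (d * k) q =
      (1 + (q ^ d) ^ k * (q ^ r + q ^ (d - r))) * schurAboveGen d r (d * (k + 1)) q +
        (q ^ d) ^ (k + 1) * (1 - (q ^ d) ^ (k + 1)) * schurAboveGen d r (d * (k + 2)) q := by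
  have hd : 0 < d := by omega
  have hskip : ∀ k s t, s ≤ t → t < d →
      (∀ u, s < u → u ≤ t → u ≠ r ∧ u ≠ d - r) →
      schurAboveGen d r (d * k + s) q = schurAboveGen d r (d * k + t) q := by
    intro k s t hst ht hu
    refine schurAboveGen_eq_of_forall_not q (by omega) fun x h₁ h₂ => ?_
    obtain ⟨u, rfl⟩ := Nat.exists_eq_add_of_le (show d * k ≤ x by omega)
    rw [isSchurPart_mul_add_iff (by omega)]
    have := hu u (by omega) (by omega)
    omega
  have hstep : ∀ k s, 0 < s → s < d → (s = r ∨ s = d - r) →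
      schurAboveGen d r (d * k + (s - 1)) q = schurAboveGen d r (d * k + s) q +
        q ^ (d * k + s) * schurAboveGen d r (d * (k + 1) + (s - 1)) q := by
    intro k s hs0 hsd hs
    obtain ⟨s, rfl⟩ := Nat.exists_eq_add_of_le' hs0
    refine schurAboveGen_eq_add hd hq ((isSchurPart_mul_add_iff hsd).mpr (Or.inr hs))
      fun a _ => ?_
    have hmul : d * (k + 1) = d * k + d := by ring
    refine ⟨fun h => ?_, fun h => ⟨?_, fun hda => lt_of_le_of_ne ?_ ?_⟩⟩
    · have := h.1
      omega
    · omega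
    · omega
    · rintro rfl
      have : d ∣ s + 1 := (Nat.dvd_add_right (Dvd.intro (k + 1) rfl : d ∣ d * (k + 1))).mp
        (by convert hda using 1; omega)
      exact absurd (Nat.le_of_dvd (by omega) this) (by omega)
  have hstep0 : schurAboveGen d r (d * k + (d - 1)) q = schurAboveGen d r (d * (k + 1)) q +
      q ^ (d * (k + 1)) * schurAboveGen d r (d * (k + 2)) q := by
    have hmul : d * (k + 1) = d * k + (d - 1) + 1 := by rw [mul_add]; omega
    have hmul2 : d * (k + 2) = d * (k + 1) + d := by ring
    rw [hmul]
    refine schurAboveGen_eq_add hd hq ?_ fun a _ => ?_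
    · rw [← hmul]
      exact Or.inl (Nat.mul_mod_right _ _)
    · rw [← hmul, hmul2]
      refine ⟨fun h => lt_of_le_of_ne h.1 ?_, fun h => ⟨h.le, fun _ => h⟩⟩
      rintro rfl
      exact lt_irrefl _ (h.2 (by rw [← hmul2]; exact Dvd.intro _ rfl))
  have a₁ := hskip k 0 (r - 1) (by omega) (by omega) (by omega)
  have a₂ := hskip (k + 1) 0 (r - 1) (by omega) (by omega) (by omega)
  have a₃ := hskip (k + 2) 0 (r - 1) (by omega) (by omega) (by omega)
  have b₁ := hskip k r (d - r - 1) (by omega) (by omega) (by omega)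
  have b₂ := hskip (k + 1) r (d - r - 1) (by omega) (by omega) (by omega)
  have c₁ := hskip k (d - r) (d - 1) (by omega) (by omega) (by omega)
  have s₁ := hstep k r (by omega) (by omega) (Or.inl rfl)
  have s₂ := hstep (k + 1) r (by omega) (by omega) (Or.inl rfl)
  have s₃ := hstep k (d - r) (by omega) (by omega) (Or.inr rfl)
  rw [add_zero] at a₁ a₂ a₃
  rw [← a₁, ← a₂] at s₁
  rw [← a₂, ← a₃] at s₂
  rw [← b₁, ← b₂, c₁] at s₃
  have hq' : (q ^ d) ^ (k + 1) = (q ^ d) ^ k * (q ^ r * q ^ (d - r)) := by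
    rw [← pow_add q, Nat.add_sub_cancel' (by omega), pow_succ]
  have e₁ : q ^ (d * k + r) = (q ^ d) ^ k * q ^ r := by rw [pow_add, pow_mul]
  have e₂ : q ^ (d * (k + 1) + r) = (q ^ d) ^ (k + 1) * q ^ r := by rw [pow_add, pow_mul]
  have e₃ : q ^ (d * k + (d - r)) = (q ^ d) ^ k * q ^ (d - r) := by rw [pow_add, pow_mul]
  rw [e₁] at s₁
  rw [e₂] at s₂
  rw [e₃] at s₃
  rw [pow_mul] at hstep0
  rw [s₁, s₃, hstep0]
  linear_combination (-(q ^ d) ^ k * q ^ (d - r)) * s₂ + (q ^ d) ^ (k + 1) *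
    schurAboveGen d r (d * (k + 2)) q * hq'

lemma schurBGen_eq_schurAboveGen {d : ℕ} (hd : 0 < d) (r : ℕ) {q : ℂ} (hq : ‖q‖ < 1) :
    schurBGen d r q = schurAboveGen d r 0 q := by
  rw [schurAboveGen, ← tsum_ncard_mul_pow (summable_norm_schurAbove hd r 0 hq).of_norm]
  refine tsum_congr fun n => ?_
  rw [schurB]
  congr 3
  ext l
  exact and_congr_left fun _ => ⟨fun h => ⟨h, fun x hx => (h.1 x hx).1⟩, fun h => h.1⟩

lemma schurCGen_eq_schurAboveGen {d : ℕ} (hd : 0 < d) (r : ℕ) {q : ℂ} (hq : ‖q‖ < 1) :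
    schurCGen d r q = schurAboveGen d r d q := by
  rw [schurAboveGen, ← tsum_ncard_mul_pow (summable_norm_schurAbove hd r d hq).of_norm]
  refine tsum_congr fun n => ?_
  rw [schurC]
  congr 3
  ext l
  exact and_assoc.symm

/-- `𝒞_{d,r}(q) = ℬ_{d,r}(q) · g₃(-q^r; q^d)`: the universal mock theta function is the
quotient of the two Schur-type generating functions. -/
theorem schurCGen_eq_schurBGen_mul_g3 (d r : ℕ) (hd : 3 ≤ d) (hr1 : 1 ≤ r) (hr2 : 2 * r < d)
    (q : ℂ) (hq : ‖q‖ < 1) :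
    schurCGen d r q = schurBGen d r q * g3 (-q ^ r) (q ^ d) := by
  have hd0 : 0 < d := by omega
  have hneg : ∀ n, n ≠ 0 → ‖-q ^ n‖ < 1 := fun n hn => by
    rw [norm_neg, norm_pow]
    exact pow_lt_one₀ (norm_nonneg _) hq hn
  have ha := hneg r (by omega)
  have hb := hneg (d - r) (by omega)
  have hQ : ‖q ^ d‖ < 1 := by simpa using hneg d (by omega)
  have hab : -q ^ r * -q ^ (d - r) = q ^ d := by
    rw [neg_mul_neg, ← pow_add, Nat.add_sub_cancel' (by omega)]
  have hinv : (-q ^ r)⁻¹ * q ^ d = -q ^ (d - r) := by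
    rcases eq_or_ne q 0 with rfl | hq0
    · simp [show d ≠ 0 by omega, show d - r ≠ 0 by omega]
    · rw [← hab, inv_mul_cancel_left₀ (neg_ne_zero.mpr (pow_ne_zero r hq0))]
  obtain ⟨A, hA⟩ := exists_norm_schurAboveGen_le hd0 r hq
  obtain ⟨B, -, hB⟩ := exists_norm_heineCoeff_le ha hQ
  have hlim : Tendsto (fun k : ℕ => (q ^ d) ^ (k + 1) * (1 - (q ^ d) ^ (k + 1))) atTop (𝓝 0) := by
    have h := (tendsto_pow_atTop_nhds_zero_of_norm_lt_one hQ).comp (tendsto_add_atTop_nat 1)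
    simpa using h.mul (h.const_sub 1)
  have hmain := mul_eq_mul_of_bounded_of_recurrence
    (F := fun k => schurAboveGen d r (d * k) q)
    (W := heineSeries (-q ^ r) (-q ^ (d - r)) (q ^ d))
    (c := fun k => 1 + (q ^ d) ^ k * (q ^ r + q ^ (d - r)))
    (schurAboveGen_recurrence hr1 hr2 hq)
    (fun k => by rw [heineSeries_recurrence ha hb hQ hab k]; ring)
    hlim (fun k => hA _) (fun k => norm_tsum_mul_pow_le hb (hB k))
  rw [heineSeries_zero, heineSeries_one hQ, tsum_eq_tsum_rogersFine ha hb hQ hab] at hmain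
  rw [schurCGen_eq_schurAboveGen hd0 r hq, schurBGen_eq_schurAboveGen hd0 r hq, g3, hinv]
  simpa using hmain.symm
end

section
/- Andrews' identity: 𝒞_{3,1}(q) = ((-q;q)_∞ / (q^6; q^6)_∞) · Σ_{n≥0} (-1)^n q^{9n(n+1)/2} (1 - q^{6n+3}) / ((1 + q^{3n+1})(1 + q^{3n+2})) for |q| < 1. -/
open scoped BigOperators

/-- The infinite q-Pochhammer symbol `(a; q)_∞`. -/
noncomputable def qPochInf (a q : ℂ) : ℂ := ∏' j : ℕ, (1 - a * q ^ j)

open Filter Topology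

section QPochhammer

lemma summable_norm_mul_pow {q : ℂ} (hq : ‖q‖ < 1) (c : ℂ) :
    Summable fun j : ℕ => ‖-(c * q ^ j)‖ := by
  simpa using (summable_geometric_of_lt_one (norm_nonneg q) hq).mul_left ‖c‖

lemma multipliable_qPochInf {q : ℂ} (hq : ‖q‖ < 1) (c : ℂ) :
    Multipliable fun j : ℕ => 1 - c * q ^ j := by
  simpa [sub_eq_add_neg] using multipliable_one_add_of_summable (summable_norm_mul_pow hq c)

lemma norm_mul_pow_lt_one_s8 {q c : ℂ} (hq : ‖q‖ < 1) (hc : ‖c‖ < 1) (j : ℕ) :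
    ‖c * q ^ j‖ < 1 := by
  rw [norm_mul, norm_pow]
  exact (mul_le_of_le_one_right (norm_nonneg c)
    (pow_le_one₀ (norm_nonneg q) hq.le)).trans_lt hc

lemma qPochInf_ne_zero {q c : ℂ} (hq : ‖q‖ < 1) (hc : ‖c‖ < 1) : qPochInf c q ≠ 0 := by
  have h := tprod_one_add_ne_zero_of_summable (f := fun j : ℕ => -(c * q ^ j))
    (fun j => by
      simpa [sub_eq_add_neg] using
        one_sub_ne_zero_of_norm_lt_one (norm_mul_pow_lt_one_s8 hq hc j))
    (summable_norm_mul_pow hq c)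
  simpa [qPochInf, sub_eq_add_neg] using h

lemma qPochInf_mul_pow {q : ℂ} (hq : ‖q‖ < 1) (c : ℂ) (n : ℕ) :
    qPochInf (c * q ^ n) q = (1 - c * q ^ n) * qPochInf (c * q ^ (n + 1)) q := by
  unfold qPochInf
  rw [tprod_eq_zero_mul']
  · congr 1
    · simp
    · exact tprod_congr fun j => by ring
  · exact (multipliable_qPochInf hq (c * q ^ (n + 1))).congr fun j => by ring

lemma tendsto_qPochInf_mul_pow {q c : ℂ} (hq : ‖q‖ < 1) (hc : ‖c‖ < 1) :
    Tendsto (fun n : ℕ => qPochInf (c * q ^ n) q) atTop (𝓝 1) := by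
  have hprod (n : ℕ) :
      (∏ j ∈ Finset.range n, (1 - c * q ^ j)) * qPochInf (c * q ^ n) q = qPochInf c q := by
    induction n with
    | zero => simp
    | succ n ih => rw [Finset.prod_range_succ, mul_assoc, ← qPochInf_mul_pow hq, ih]
  have h0 := qPochInf_ne_zero hq hc
  have hlim : Tendsto (fun n => ∏ j ∈ Finset.range n, (1 - c * q ^ j)) atTop
      (𝓝 (qPochInf c q)) := (multipliable_qPochInf hq c).tendsto_prod_tprod_nat
  have := (tendsto_const_nhds (x := qPochInf c q)).div hlim h0
  rw [div_self h0] at this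
  refine this.congr fun n => ?_
  rw [Pi.div_apply, ← hprod n, mul_div_cancel_left₀]
  exact left_ne_zero_of_mul (hprod n ▸ h0)

lemma qPochInf_neg_mul_self {q : ℂ} (hq : ‖q‖ < 1) :
    qPochInf (-q) q * qPochInf q q = qPochInf (q ^ 2) (q ^ 2) := by
  unfold qPochInf
  rw [← (multipliable_qPochInf hq _).tprod_mul (multipliable_qPochInf hq _)]
  exact tprod_congr fun j => by ring

lemma norm_pow_lt_one {q : ℂ} (hq : ‖q‖ < 1) {n : ℕ} (hn : n ≠ 0) : ‖q ^ n‖ < 1 := by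
  rw [norm_pow]
  exact pow_lt_one₀ (norm_nonneg q) hq hn

lemma qPochInf_trisection {q : ℂ} (hq : ‖q‖ < 1) :
    qPochInf (-q) q =
      qPochInf (-q) (q ^ 3) * qPochInf (-q ^ 2) (q ^ 3) * qPochInf (-q ^ 3) (q ^ 3) := by
  have hq3 : ‖q ^ 3‖ < 1 := norm_pow_lt_one hq (by norm_num)
  have hlim (c : ℂ) := (multipliable_qPochInf hq3 c).tendsto_prod_tprod_nat
  have h3 : Tendsto (fun n : ℕ => 3 * n) atTop atTop :=
    tendsto_id.const_mul_atTop' (by norm_num)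
  refine tendsto_nhds_unique
    ((multipliable_qPochInf hq (-q)).tendsto_prod_tprod_nat.comp h3)
    ((((hlim (-q)).mul (hlim (-q ^ 2))).mul (hlim (-q ^ 3))).congr fun n => ?_)
  induction n with
  | zero => simp
  | succ n ih =>
    simp only [Function.comp_apply, Finset.prod_range_succ, mul_add, mul_one] at ih ⊢
    rw [← ih]
    ring

end QPochhammer

section Recurrence

lemma eq_zero_of_second_order_recurrence {D α β : ℕ → ℂ} {c : ℕ → ℝ}
    (hrec : ∀ m, D m = α m * D (m + 1) + β m * D (m + 2))
    (hc : Summable c) (hc0 : ∀ m, 0 ≤ c m) (hαβ : ∀ m, ‖α m‖ + ‖β m‖ ≤ 1 + c m)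
    (hD : Tendsto D atTop (𝓝 0)) (m : ℕ) : D m = 0 := by
  set M : ℕ → ℝ := fun m => max ‖D m‖ ‖D (m + 1)‖ with hM
  have hM0 (m) : 0 ≤ M m := le_max_of_le_left (norm_nonneg _)
  have hstep (m) : M m ≤ Real.exp (c m) * M (m + 1) := by
    have h1 : 1 + c m ≤ Real.exp (c m) := by linarith [Real.add_one_le_exp (c m)]
    have h2 : M m ≤ (1 + c m) * M (m + 1) := by
      refine max_le ?_ ?_
      · calc ‖D m‖ ≤ ‖α m‖ * ‖D (m + 1)‖ + ‖β m‖ * ‖D (m + 2)‖ := by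
              rw [hrec m, ← norm_mul, ← norm_mul]; exact norm_add_le _ _
          _ ≤ ‖α m‖ * M (m + 1) + ‖β m‖ * M (m + 1) := by
              gcongr
              · exact le_max_left _ _
              · exact le_max_right _ _
          _ ≤ (1 + c m) * M (m + 1) := by
              rw [← add_mul]; exact mul_le_mul_of_nonneg_right (hαβ m) (hM0 _)
      · calc ‖D (m + 1)‖ ≤ M (m + 1) := le_max_left _ _
          _ ≤ (1 + c m) * M (m + 1) := by nlinarith [hc0 m, hM0 (m + 1)]
    exact h2.trans (mul_le_mul_of_nonneg_right h1 (hM0 _))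
  set E : ℕ → ℝ := fun m => Real.exp (∑ i ∈ Finset.range m, c i) * M m with hE
  have hmono : Monotone E := monotone_nat_of_le_succ fun m => by
    simp only [hE, Finset.sum_range_succ, Real.exp_add, mul_assoc]
    exact mul_le_mul_of_nonneg_left (hstep m) (Real.exp_pos _).le
  have hMlim : Tendsto M atTop (𝓝 0) := by
    have h := hD.norm
    rw [norm_zero] at h
    simpa using h.max (h.comp (tendsto_add_atTop_nat 1))
  have hElim : Tendsto E atTop (𝓝 0) := by
    simpa using ((Real.continuous_exp.tendsto _).comp hc.hasSum.tendsto_sum_nat).mul hMlim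
  have hle : E m ≤ 0 := hmono.ge_of_tendsto hElim m
  have : M m ≤ 0 := by
    by_contra h
    exact absurd hle (not_le.mpr (mul_pos (Real.exp_pos _) (not_le.mp h)))
  exact norm_le_zero_iff.mp ((le_max_left _ _).trans this)

end Recurrence

section Watson

variable {a b p : ℂ}

/-- The factor of `watsonTerm a b p m n` that does not depend on `m`. -/
noncomputable def watsonCoeff (a b p : ℂ) (n : ℕ) : ℂ :=
  qPochInf (-a) p * qPochInf (-b) p / qPochInf p p * ((-1) ^ n * p ^ (3 * (n * (n + 1) / 2))) *
    (qPochInf (p * p ^ n) p / (qPochInf (-a * p ^ n) p * qPochInf (-b * p ^ n) p))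

/-- The quotient of infinite products entering `watsonTerm`. -/
noncomputable def watsonTail (a b p : ℂ) (n : ℕ) : ℂ :=
  qPochInf (-a * p ^ (n + 1)) p * qPochInf (-b * p ^ (n + 1)) p / qPochInf (p * p ^ n) p

/-- The `n`-th term of the very-well-poised series obtained as a limiting case of Watson's
transformation, with base point `x = p ^ (m + 1)`. -/
noncomputable def watsonTerm (a b p : ℂ) (m n : ℕ) : ℂ :=
  watsonCoeff a b p n * p ^ (2 * m * n) * (1 - p ^ (2 * n + m + 1)) * watsonTail a b p (n + m)

/-- The telescoping certificate for the recurrence in `m` satisfied by `watsonTerm`. -/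
noncomputable def watsonCert (a b p : ℂ) (m n : ℕ) : ℂ :=
  watsonCoeff a b p n * p ^ (2 * m * n) *
    (qPochInf (-a * p ^ (n + m + 2)) p * qPochInf (-b * p ^ (n + m + 2)) p /
      qPochInf (p * p ^ (n + m)) p) * (1 - p ^ n) *
    (-1 - (1 + p ^ (m + 1) * (a + b)) * p ^ n +
      p ^ (m + 1) * (1 - p ^ (m + 2)) * p ^ (2 * n))

lemma qPochInf_mul_pow_ne_zero {q c : ℂ} (hq : ‖q‖ < 1) (hc : ‖c‖ < 1) (n : ℕ) :
    qPochInf (c * q ^ n) q ≠ 0 :=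
  qPochInf_ne_zero hq (norm_mul_pow_lt_one_s8 hq hc n)

lemma qPochInf_neg_mul_pow (hp : ‖p‖ < 1) (c : ℂ) (n : ℕ) :
    qPochInf (-c * p ^ n) p = (1 + c * p ^ n) * qPochInf (-c * p ^ (n + 1)) p := by
  rw [qPochInf_mul_pow hp, neg_mul, sub_neg_eq_add]

lemma qPochInf_self_mul_pow (hp : ‖p‖ < 1) (n : ℕ) :
    qPochInf (p * p ^ n) p = (1 - p ^ (n + 1)) * qPochInf (p * p ^ (n + 1)) p := by
  rw [qPochInf_mul_pow hp p n, pow_succ' p n]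

lemma inv_qPochInf_succ (hp : ‖p‖ < 1) (n : ℕ) :
    (qPochInf (p * p ^ (n + 1)) p)⁻¹ = (1 - p ^ (n + 1)) * (qPochInf (p * p ^ n) p)⁻¹ := by
  have h1 : 1 - p ^ (n + 1) ≠ 0 :=
    one_sub_ne_zero_of_norm_lt_one (norm_pow_lt_one hp n.succ_ne_zero)
  rw [qPochInf_self_mul_pow hp n, mul_inv, mul_inv_cancel_left₀ h1]

lemma watsonCoeff_succ (hp : ‖p‖ < 1) (ha : ‖a‖ < 1) (hb : ‖b‖ < 1) (n : ℕ) :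
    watsonCoeff a b p (n + 1) * (1 - p ^ (n + 1)) =
      -(watsonCoeff a b p n * p ^ (3 * n + 3) * (1 + a * p ^ n) * (1 + b * p ^ n)) := by
  have hA := qPochInf_mul_pow_ne_zero hp (c := -a) (by simpa using ha) n
  have hB := qPochInf_mul_pow_ne_zero hp (c := -b) (by simpa using hb) n
  rw [qPochInf_neg_mul_pow hp] at hA hB
  have htri : (n + 1) * (n + 1 + 1) / 2 = n * (n + 1) / 2 + (n + 1) := by
    rw [show (n + 1) * (n + 1 + 1) = n * (n + 1) + (n + 1) * 2 by ring,
      Nat.add_mul_div_right _ _ two_pos]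
  unfold watsonCoeff
  rw [htri, qPochInf_self_mul_pow hp n, qPochInf_neg_mul_pow hp a n, qPochInf_neg_mul_pow hp b n]
  obtain ⟨hA1, hA2⟩ := mul_ne_zero_iff.mp hA
  obtain ⟨hB1, hB2⟩ := mul_ne_zero_iff.mp hB
  generalize qPochInf (-a * p ^ (n + 1)) p = A at *
  generalize qPochInf (-b * p ^ (n + 1)) p = B at *
  generalize qPochInf (p * p ^ (n + 1)) p = P
  field_simp
  ring

lemma watsonTerm_recurrence (hp : ‖p‖ < 1) (ha : ‖a‖ < 1) (hb : ‖b‖ < 1) (hab : a * b = p)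
    (m n : ℕ) :
    watsonTerm a b p m n - (1 + p ^ (m + 1) * (a + b)) * watsonTerm a b p (m + 1) n -
        p ^ (m + 2) * (1 - p ^ (m + 2)) * watsonTerm a b p (m + 2) n =
      watsonCert a b p m (n + 1) - watsonCert a b p m n := by
  have hF := watsonCoeff_succ hp ha hb n
  have hcert : watsonCert a b p m (n + 1) =
      watsonCoeff a b p (n + 1) * (1 - p ^ (n + 1)) * p ^ (2 * m * (n + 1)) *
        (qPochInf (-a * p ^ (n + m + 3)) p * qPochInf (-b * p ^ (n + m + 3)) p *
          (qPochInf (p * p ^ (n + m + 1)) p)⁻¹) *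
        (-1 - (1 + p ^ (m + 1) * (a + b)) * p ^ (n + 1) +
          p ^ (m + 1) * (1 - p ^ (m + 2)) * p ^ (2 * (n + 1))) := by
    unfold watsonCert
    rw [show n + 1 + m = n + m + 1 by ring]
    ring
  rw [hcert, hF]
  unfold watsonTerm watsonCert watsonTail
  simp only [div_eq_mul_inv, ← add_assoc]
  rw [inv_qPochInf_succ hp (n + m + 1), inv_qPochInf_succ hp (n + m),
    qPochInf_neg_mul_pow hp a (n + m + 1), qPochInf_neg_mul_pow hp b (n + m + 1),
    qPochInf_neg_mul_pow hp a (n + m + 1 + 1), qPochInf_neg_mul_pow hp b (n + m + 1 + 1)]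
  rw [show 2 * m * (n + 1) = 2 * m * n + m * 2 by ring,
    show 2 * (m + 1) * n = 2 * m * n + n * 2 by ring,
    show 2 * (m + 2) * n = 2 * m * n + n * 4 by ring]
  simp only [show n + m + 1 + 1 + 1 = n + m + 3 from rfl]
  generalize qPochInf (-a * p ^ (n + m + 3)) p = A
  generalize qPochInf (-b * p ^ (n + m + 3)) p = B
  generalize (qPochInf (p * p ^ (n + m)) p)⁻¹ = R
  generalize watsonCoeff a b p n = F
  simp only [mul_add, mul_one, pow_add, pow_mul, mul_comm 3 n, mul_comm 2 n]
  generalize p ^ n = N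
  generalize ((p ^ 2) ^ m) ^ n = W
  generalize p ^ m = Z
  subst hab
  ring

lemma exists_norm_le_of_tendsto {f : ℕ → ℂ} {x : ℂ} (hf : Tendsto f atTop (𝓝 x)) :
    ∃ C, 0 ≤ C ∧ ∀ n, ‖f n‖ ≤ C := by
  obtain ⟨C, hC⟩ := hf.norm.bddAbove_range
  have hC' (n) : ‖f n‖ ≤ C := hC ⟨n, rfl⟩
  exact ⟨C, (norm_nonneg _).trans (hC' 0), hC'⟩

lemma tendsto_watsonTail (hp : ‖p‖ < 1) (ha : ‖a‖ < 1) (hb : ‖b‖ < 1) :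
    Tendsto (watsonTail a b p) atTop (𝓝 1) := by
  have hA := (tendsto_qPochInf_mul_pow hp (c := -a) (by simpa using ha)).comp
    (tendsto_add_atTop_nat 1)
  have hB := (tendsto_qPochInf_mul_pow hp (c := -b) (by simpa using hb)).comp
    (tendsto_add_atTop_nat 1)
  have := (hA.mul hB).div (tendsto_qPochInf_mul_pow hp hp) one_ne_zero
  rw [mul_one, div_one] at this
  exact this

lemma exists_norm_watsonCoeff_le (hp : ‖p‖ < 1) (ha : ‖a‖ < 1) (hb : ‖b‖ < 1) :
    ∃ C, 0 ≤ C ∧ ∀ n, ‖watsonCoeff a b p n‖ ≤ C * ‖p‖ ^ n := by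
  have hA := tendsto_qPochInf_mul_pow hp (c := -a) (by simpa using ha)
  have hB := tendsto_qPochInf_mul_pow hp (c := -b) (by simpa using hb)
  have hlim := (tendsto_const_nhds
    (x := qPochInf (-a) p * qPochInf (-b) p / qPochInf p p)).mul
      ((tendsto_qPochInf_mul_pow hp hp).div (hA.mul hB) (by simp))
  obtain ⟨C, hC0, hC⟩ := exists_norm_le_of_tendsto hlim
  refine ⟨C, hC0, fun n => ?_⟩
  have hn : n ≤ 3 * (n * (n + 1) / 2) := by
    rcases n with _ | n
    · simp
    · have : n + 1 ≤ (n + 1) * (n + 1 + 1) / 2 := by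
        rw [Nat.le_div_iff_mul_le two_pos]; gcongr; omega
      omega
  have hpow : ‖(-1 : ℂ) ^ n * p ^ (3 * (n * (n + 1) / 2))‖ ≤ ‖p‖ ^ n := by
    simpa using pow_le_pow_of_le_one (norm_nonneg p) hp.le hn
  unfold watsonCoeff
  rw [mul_right_comm, norm_mul]
  exact mul_le_mul (hC n) hpow (norm_nonneg _) hC0

lemma norm_pow_le_one_of_norm_lt_one (hp : ‖p‖ < 1) (n : ℕ) : ‖p ^ n‖ ≤ 1 := by
  rw [norm_pow]
  exact pow_le_one₀ (norm_nonneg p) hp.le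

lemma norm_one_sub_pow_le_two (hp : ‖p‖ < 1) (n : ℕ) : ‖1 - p ^ n‖ ≤ 2 := by
  refine (norm_sub_le _ _).trans ?_
  rw [norm_one]
  linarith [norm_pow_le_one_of_norm_lt_one hp n]

lemma exists_norm_watsonTerm_le (hp : ‖p‖ < 1) (ha : ‖a‖ < 1) (hb : ‖b‖ < 1) :
    ∃ C, ∀ m n, ‖watsonTerm a b p m n‖ ≤ C * ‖p‖ ^ n := by
  obtain ⟨C, hC0, hC⟩ := exists_norm_watsonCoeff_le hp ha hb
  obtain ⟨K, hK0, hK⟩ := exists_norm_le_of_tendsto (tendsto_watsonTail hp ha hb)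
  refine ⟨C * 2 * K, fun m n => ?_⟩
  unfold watsonTerm
  simp only [norm_mul]
  calc _ ≤ C * ‖p‖ ^ n * 1 * 2 * K := by
        gcongr
        · exact hC n
        · exact norm_pow_le_one_of_norm_lt_one hp _
        · exact norm_one_sub_pow_le_two hp _
        · exact hK _
    _ = _ := by ring

lemma summable_watsonTerm (hp : ‖p‖ < 1) (ha : ‖a‖ < 1) (hb : ‖b‖ < 1) (m : ℕ) :
    Summable (watsonTerm a b p m) := by
  obtain ⟨C, hC⟩ := exists_norm_watsonTerm_le hp ha hb
  exact ((summable_geometric_of_lt_one (norm_nonneg p) hp).mul_left C).of_norm_bounded (hC m)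

lemma tendsto_watsonCert (hp : ‖p‖ < 1) (ha : ‖a‖ < 1) (hb : ‖b‖ < 1) (m : ℕ) :
    Tendsto (watsonCert a b p m) atTop (𝓝 0) := by
  obtain ⟨C, hC0, hC⟩ := exists_norm_watsonCoeff_le hp ha hb
  have hpn : Tendsto (fun n => p ^ n) atTop (𝓝 0) := tendsto_pow_atTop_nhds_zero_of_norm_lt_one hp
  have hF : Tendsto (fun n => watsonCoeff a b p n * p ^ (2 * m * n)) atTop (𝓝 0) := by
    refine squeeze_zero_norm (a := fun n => C * ‖p‖ ^ n) (fun n => ?_) ?_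
    · rw [norm_mul]
      exact (mul_le_of_le_one_right (norm_nonneg _)
        (norm_pow_le_one_of_norm_lt_one hp _)).trans (hC n)
    · simpa using (tendsto_pow_atTop_nhds_zero_of_lt_one (norm_nonneg p) hp).const_mul C
  have hA := (tendsto_qPochInf_mul_pow hp (c := -a) (by simpa using ha)).comp
    (tendsto_add_atTop_nat (m + 2))
  have hB := (tendsto_qPochInf_mul_pow hp (c := -b) (by simpa using hb)).comp
    (tendsto_add_atTop_nat (m + 2))
  have hP := (tendsto_qPochInf_mul_pow hp hp).comp (tendsto_add_atTop_nat m)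
  have h2 : Tendsto (fun n => p ^ (2 * n)) atTop (𝓝 0) := by
    simpa [two_mul, pow_add] using hpn.mul hpn
  have hh := ((hpn.const_mul (1 + p ^ (m + 1) * (a + b))).const_sub (-1)).add
    (h2.const_mul (p ^ (m + 1) * (1 - p ^ (m + 2))))
  have := ((hF.mul ((hA.mul hB).div hP one_ne_zero)).mul (hpn.const_sub 1)).mul hh
  simp only [zero_mul] at this
  exact this

/-- The sum over `n` of `watsonTerm a b p m n`. -/
noncomputable def watsonSum (a b p : ℂ) (m : ℕ) : ℂ := ∑' n, watsonTerm a b p m n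

lemma watsonSum_recurrence (hp : ‖p‖ < 1) (ha : ‖a‖ < 1) (hb : ‖b‖ < 1) (hab : a * b = p)
    (m : ℕ) :
    watsonSum a b p m = (1 + p ^ (m + 1) * (a + b)) * watsonSum a b p (m + 1) +
      p ^ (m + 2) * (1 - p ^ (m + 2)) * watsonSum a b p (m + 2) := by
  have hs (m) := (summable_watsonTerm hp ha hb m).hasSum
  have h := (((hs m).sub ((hs (m + 1)).mul_left (1 + p ^ (m + 1) * (a + b)))).sub
    ((hs (m + 2)).mul_left (p ^ (m + 2) * (1 - p ^ (m + 2))))).tendsto_sum_nat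
  simp only [watsonTerm_recurrence hp ha hb hab, Finset.sum_range_sub] at h
  have h0 : watsonCert a b p m 0 = 0 := by simp [watsonCert]
  have h' := tendsto_nhds_unique h (by simpa [h0] using tendsto_watsonCert hp ha hb m)
  unfold watsonSum
  linear_combination h'

lemma tendsto_watsonSum (hp : ‖p‖ < 1) (ha : ‖a‖ < 1) (hb : ‖b‖ < 1) :
    Tendsto (watsonSum a b p) atTop (𝓝 1) := by
  obtain ⟨C, hC⟩ := exists_norm_watsonTerm_le hp ha hb
  have hpn : Tendsto (fun n => p ^ n) atTop (𝓝 0) := tendsto_pow_atTop_nhds_zero_of_norm_lt_one hp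
  have hlim (n : ℕ) :
      Tendsto (fun m => watsonTerm a b p m n) atTop (𝓝 (if n = 0 then 1 else 0)) := by
    have htail := (tendsto_watsonTail hp ha hb).comp (tendsto_add_atTop_nat n)
    have hsub : Tendsto (fun m => 1 - p ^ (2 * n + m + 1)) atTop (𝓝 1) := by
      have := (hpn.comp (tendsto_add_atTop_nat (2 * n + 1))).const_sub 1
      rw [sub_zero] at this
      refine this.congr fun m => ?_
      rw [Function.comp_apply, show m + (2 * n + 1) = 2 * n + m + 1 by ring]
    have hpow : Tendsto (fun m => watsonCoeff a b p n * p ^ (2 * m * n)) atTop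
        (𝓝 (if n = 0 then 1 else 0)) := by
      rcases eq_or_ne n 0 with rfl | hn
      · have hA := qPochInf_ne_zero hp (c := -a) (by simpa using ha)
        have hB := qPochInf_ne_zero hp (c := -b) (by simpa using hb)
        have hP := qPochInf_ne_zero hp hp
        have : watsonCoeff a b p 0 = 1 := by
          simp only [watsonCoeff, pow_zero, mul_one, zero_mul, Nat.zero_div, mul_zero]
          field_simp
        simp [this]
      · have h := (tendsto_pow_atTop_nhds_zero_of_norm_lt_one
          (norm_pow_lt_one hp (mul_ne_zero two_ne_zero hn))).const_mul (watsonCoeff a b p n)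
        simp only [mul_zero] at h
        simp only [hn, if_false]
        refine h.congr fun m => ?_
        rw [← pow_mul]
        ring_nf
    have := (hpow.mul hsub).mul htail
    simp only [mul_one] at this
    refine this.congr fun m => ?_
    rw [Function.comp_apply, add_comm m n, watsonTerm]
  have h := tendsto_tsum_of_dominated_convergence
    ((summable_geometric_of_lt_one (norm_nonneg p) hp).mul_left C) hlim
    (Eventually.of_forall fun m n => hC m n)
  rwa [tsum_ite_eq] at h

lemma watsonSum_zero (hp : ‖p‖ < 1) (ha : ‖a‖ < 1) (hb : ‖b‖ < 1) :
    watsonSum a b p 0 = qPochInf (-a) p * qPochInf (-b) p / qPochInf p p *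
      ∑' n : ℕ, (-1) ^ n * p ^ (3 * (n * (n + 1) / 2)) * (1 - p ^ (2 * n + 1)) /
        ((1 + a * p ^ n) * (1 + b * p ^ n)) := by
  rw [watsonSum, ← tsum_mul_left]
  refine tsum_congr fun n => ?_
  have hA := qPochInf_mul_pow_ne_zero hp (c := -a) (by simpa using ha) n
  have hB := qPochInf_mul_pow_ne_zero hp (c := -b) (by simpa using hb) n
  have hP := qPochInf_mul_pow_ne_zero hp hp n
  have hP0 := qPochInf_ne_zero hp hp
  rw [qPochInf_neg_mul_pow hp] at hA hB
  simp only [watsonTerm, watsonTail, watsonCoeff, mul_zero, zero_mul, pow_zero, add_zero, mul_one]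
  rw [qPochInf_neg_mul_pow hp a n, qPochInf_neg_mul_pow hp b n]
  obtain ⟨hA1, hA2⟩ := mul_ne_zero_iff.mp hA
  obtain ⟨hB1, hB2⟩ := mul_ne_zero_iff.mp hB
  generalize qPochInf (-a * p ^ (n + 1)) p = A at *
  generalize qPochInf (-b * p ^ (n + 1)) p = B at *
  generalize qPochInf (p * p ^ n) p = P at *
  field_simp

lemma eq_watsonSum_of_recurrence (hp : ‖p‖ < 1) (ha : ‖a‖ < 1) (hb : ‖b‖ < 1)
    (hab : a * b = p) {u : ℕ → ℂ} (hlim : Tendsto u atTop (𝓝 1))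
    (hu : ∀ m, u m = (1 + p ^ (m + 1) * (a + b)) * u (m + 1) +
      p ^ (m + 2) * (1 - p ^ (m + 2)) * u (m + 2)) (m : ℕ) :
    u m = watsonSum a b p m := by
  rw [← sub_eq_zero]
  refine eq_zero_of_second_order_recurrence (D := fun m => u m - watsonSum a b p m)
    (α := fun m => 1 + p ^ (m + 1) * (a + b)) (β := fun m => p ^ (m + 2) * (1 - p ^ (m + 2)))
    (c := fun m => (‖a + b‖ + 2) * ‖p‖ ^ m) (fun m => ?_)
    ((summable_geometric_of_lt_one (norm_nonneg p) hp).mul_left _) (fun m => by positivity)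
    (fun m => ?_) ?_ m
  · simp only [hu m, watsonSum_recurrence hp ha hb hab m]
    ring
  · have h1 : ‖p ^ (m + 1)‖ ≤ ‖p‖ ^ m := by
      rw [norm_pow]; exact pow_le_pow_of_le_one (norm_nonneg p) hp.le (by omega)
    have h2 : ‖p ^ (m + 2)‖ ≤ ‖p‖ ^ m := by
      rw [norm_pow]; exact pow_le_pow_of_le_one (norm_nonneg p) hp.le (by omega)
    calc _ ≤ (1 + ‖p ^ (m + 1)‖ * ‖a + b‖) + ‖p ^ (m + 2)‖ * ‖1 - p ^ (m + 2)‖ := by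
          rw [← norm_mul, ← norm_mul]
          gcongr
          simpa using norm_add_le (1 : ℂ) (p ^ (m + 1) * (a + b))
      _ ≤ (1 + ‖p‖ ^ m * ‖a + b‖) + ‖p‖ ^ m * 2 := by
          gcongr
          exact norm_one_sub_pow_le_two hp _
      _ = _ := by ring
  · simpa using hlim.sub (tendsto_watsonSum hp ha hb)

end Watson

section SchurPartitions

/-- The partitions counted by `schurC 3 1`, with the smallest part at least `m`. -/
def schurSet (m : ℕ) : Set (List ℕ) :=
  {l | l.Pairwise (fun a b => b + 3 ≤ a ∧ (3 ∣ a → b + 3 < a)) ∧ ∀ x ∈ l, m ≤ x}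

lemma isSchurPartition_and_three_lt_iff (l : List ℕ) :
    (IsSchurPartition 3 1 l ∧ ∀ x ∈ l, 3 < x) ↔ l ∈ schurSet 4 := by
  have htrans : IsTrans ℕ (fun a b => b + 3 ≤ a ∧ (3 ∣ a → b + 3 < a)) :=
    ⟨fun x y z hxy hyz => ⟨by omega, fun _ => by omega⟩⟩
  have hpw : l.Chain' (fun a b => b + 3 ≤ a ∧ (3 ∣ a → b + 3 < a)) ↔
      l.Pairwise (fun a b => b + 3 ≤ a ∧ (3 ∣ a → b + 3 < a)) := List.isChain_iff_pairwise
  rw [IsSchurPartition, hpw, schurSet, Set.mem_ofPred_eq]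
  constructor
  · rintro ⟨⟨_, h⟩, h3⟩
    exact ⟨h, h3⟩
  · rintro ⟨h, h4⟩
    exact ⟨⟨fun x hx => by have := h4 x hx; omega, h⟩, h4⟩

lemma schurSet_anti {m n : ℕ} (h : m ≤ n) : schurSet n ⊆ schurSet m :=
  fun _ hl => ⟨hl.1, fun x hx => h.trans (hl.2 x hx)⟩

lemma schurSet_eq_union (m : ℕ) :
    schurSet m = schurSet (m + 1) ∪
      (fun l => l ++ [m]) '' schurSet (m + if 3 ∣ m then 4 else 3) := by
  ext l
  constructor
  · rintro ⟨hl, hm⟩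
    rcases List.eq_nil_or_concat l with rfl | ⟨L, y, rfl⟩
    · exact Or.inl ⟨hl, by simp⟩
    · have hy : m ≤ y := hm y (by simp)
      rw [List.concat_eq_append, List.pairwise_append] at hl
      obtain ⟨hL, -, hLy⟩ := hl
      rcases hy.eq_or_lt with rfl | hy
      · refine Or.inr ⟨L, ⟨hL, fun x hx => ?_⟩, by simp⟩
        have := hLy x hx m (by simp)
        split_ifs <;> omega
      · refine Or.inl ⟨?_, fun x hx => ?_⟩
        · rw [List.concat_eq_append, List.pairwise_append]
          exact ⟨hL, by simp, hLy⟩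
        · rw [List.concat_eq_append, List.mem_append, List.mem_singleton] at hx
          rcases hx with hx | rfl
          · have := hLy x hx y (by simp)
            omega
          · exact hy
  · rintro (h | ⟨L, ⟨hL, hm⟩, rfl⟩)
    · exact schurSet_anti m.le_succ h
    · refine ⟨List.pairwise_append.mpr ⟨hL, by simp, fun x hx y hy => ?_⟩, fun x hx => ?_⟩
      · rw [List.mem_singleton] at hy
        subst hy
        have := hm x hx
        split_ifs at this <;> omega
      · rw [List.mem_append, List.mem_singleton] at hx
        rcases hx with hx | rfl
        · have := hm x hx
          omega
        · exact le_rfl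

lemma disjoint_schurSet_succ_image (m : ℕ) (s : Set (List ℕ)) :
    Disjoint (schurSet (m + 1)) ((fun l => l ++ [m]) '' s) := by
  rw [Set.disjoint_left]
  rintro _ hl ⟨L, -, rfl⟩
  have := hl.2 m (by simp)
  omega

lemma summable_schurSet_norm {q : ℂ} (hq : ‖q‖ < 1) (m : ℕ) :
    Summable fun l : schurSet m => ‖q ^ l.1.sum‖ := by
  have hfin := summable_finsetProd_of_summable_norm (f := fun i : ℕ => ‖q‖ ^ i)
    (by simpa using summable_geometric_of_lt_one (norm_nonneg q) hq)
  have hgt {l : List ℕ} (hl : l ∈ schurSet m) : l.Pairwise (· > ·) :=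
    hl.1.imp fun h => by omega
  have hinj : Function.Injective fun l : schurSet m => l.1.toFinset := by
    rintro ⟨l, hl⟩ ⟨l', hl'⟩ h
    have hperm := List.perm_of_nodup_nodup_toFinset_eq (hgt hl).nodup (hgt hl').nodup h
    exact Subtype.ext (hperm.eq_of_pairwise (fun _ _ _ _ h h' => absurd h (lt_asymm h'))
      (hgt hl) (hgt hl'))
  refine (hfin.comp_injective hinj).congr fun l => ?_
  rw [Function.comp_apply, Finset.prod_pow_eq_pow_sum, norm_pow,
    List.sum_toFinset _ (hgt l.2).nodup, List.map_id']

/-- The generating function of the partitions in `schurSet m`. -/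
noncomputable def schurSetGen (q : ℂ) (m : ℕ) : ℂ := ∑' l : schurSet m, q ^ l.1.sum

lemma schurSetGen_eq_add {q : ℂ} (hq : ‖q‖ < 1) (m : ℕ) :
    schurSetGen q m =
      schurSetGen q (m + 1) + q ^ m * schurSetGen q (m + if 3 ∣ m then 4 else 3) := by
  have hinj : Function.Injective fun l : List ℕ => l ++ [m] := List.append_left_injective [m]
  have hs (n) : Summable ((fun l : List ℕ => q ^ l.sum) ∘ ((↑) : schurSet n → List ℕ)) :=
    (summable_schurSet_norm hq n).of_norm
  have hunion := schurSet_eq_union m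
  generalize m + (if 3 ∣ m then 4 else 3) = k at *
  have himage : Summable ((fun l : List ℕ => q ^ l.sum) ∘
      ((↑) : ((fun l => l ++ [m]) '' schurSet k) → List ℕ)) := by
    have hsub : (fun l => l ++ [m]) '' schurSet k ⊆ schurSet m := by
      rw [hunion]; exact Set.subset_union_right
    rw [summable_subtype_iff_indicator]
    have h := (summable_subtype_iff_indicator.mp (hs m)).indicator
      ((fun l => l ++ [m]) '' schurSet k)
    rwa [Set.indicator_indicator, Set.inter_eq_left.mpr hsub] at h
  unfold schurSetGen
  rw [hunion, Summable.tsum_union_disjoint (f := fun l : List ℕ => q ^ l.sum)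
    (disjoint_schurSet_succ_image m _) (hs (m + 1)) himage,
    tsum_image (fun l : List ℕ => q ^ l.sum) hinj.injOn, ← tsum_mul_left]
  congr 1
  exact tsum_congr fun l => by rw [List.sum_append, List.sum_singleton, pow_add, mul_comm]

lemma schurSetGen_recurrence {q : ℂ} (hq : ‖q‖ < 1) (m : ℕ) :
    schurSetGen q (3 * m + 4) =
      (1 + (q ^ 3) ^ (m + 1) * (q + q ^ 2)) * schurSetGen q (3 * (m + 1) + 4) +
        (q ^ 3) ^ (m + 2) * (1 - (q ^ 3) ^ (m + 2)) * schurSetGen q (3 * (m + 2) + 4) := by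
  have h1 := schurSetGen_eq_add hq (3 * m + 4)
  have h2 := schurSetGen_eq_add hq (3 * m + 5)
  have h3 := schurSetGen_eq_add hq (3 * m + 6)
  have h4 := schurSetGen_eq_add hq (3 * m + 7)
  rw [if_neg (by omega)] at h1 h2 h4
  rw [if_pos (by omega)] at h3
  simp only [add_assoc, Nat.reduceAdd] at h1 h2 h3 h4
  rw [show 3 * (m + 1) + 4 = 3 * m + 7 by ring, show 3 * (m + 2) + 4 = 3 * m + 10 by ring,
    h1, h2, h3]
  have h8 : schurSetGen q (3 * m + 8) =
      schurSetGen q (3 * m + 7) - q ^ (3 * m + 7) * schurSetGen q (3 * m + 10) := by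
    rw [h4]; ring
  rw [h8]
  simp only [← pow_mul]
  ring

lemma tendsto_schurSetGen {q : ℂ} (hq : ‖q‖ < 1) :
    Tendsto (schurSetGen q) atTop (𝓝 1) := by
  have hbound : Summable ((schurSet 0).indicator fun l => ‖q ^ l.sum‖) :=
    summable_subtype_iff_indicator.mp (summable_schurSet_norm hq 0)
  have hlim (l : List ℕ) : Tendsto (fun m => (schurSet m).indicator (fun l => q ^ l.sum) l) atTop
      (𝓝 (if l = [] then 1 else 0)) := by
    rcases l with _ | ⟨x, l⟩
    · refine tendsto_const_nhds.congr fun m => ?_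
      have : [] ∈ schurSet m := ⟨by simp, by simp⟩
      simp [this]
    · refine tendsto_const_nhds.congr' ?_
      filter_upwards [eventually_gt_atTop x] with m hm
      have : x :: l ∉ schurSet m := fun h => absurd (h.2 x (by simp)) (by omega)
      simp [this]
  have h := tendsto_tsum_of_dominated_convergence hbound hlim (Eventually.of_forall fun m l => by
    rw [norm_indicator_eq_indicator_norm]
    exact Set.indicator_le_indicator_of_subset (schurSet_anti m.zero_le)
      (fun _ => norm_nonneg _) l)
  rw [tsum_ite_eq] at h
  refine h.congr fun m => ?_
  rw [schurSetGen, tsum_subtype (schurSet m) fun l => q ^ l.sum]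

lemma schurCGen_eq_schurSetGen {q : ℂ} (hq : ‖q‖ < 1) :
    schurCGen 3 1 q = schurSetGen q 4 := by
  have hs : Summable fun l : schurSet 4 => q ^ l.1.sum := (summable_schurSet_norm hq 4).of_norm
  rw [schurCGen, schurSetGen, ← (hs.hasSum.tsum_fiberwise fun l => l.1.sum).tsum_eq]
  refine tsum_congr fun n => ?_
  have hfib (l : (fun l : schurSet 4 => l.1.sum) ⁻¹' {n}) : q ^ l.1.1.sum = q ^ n := by
    rw [show l.1.1.sum = n from l.2]
  rw [tsum_congr hfib, tsum_const, nsmul_eq_mul]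
  congr 2
  have himage : {l : List ℕ | IsSchurPartition 3 1 l ∧ (∀ x ∈ l, 3 < x) ∧ l.sum = n} =
      Subtype.val '' ((fun l : schurSet 4 => l.1.sum) ⁻¹' {n}) := by
    ext l
    rw [Set.mem_ofPred_eq, ← and_assoc, isSchurPartition_and_three_lt_iff]
    constructor
    · rintro ⟨hl, hn⟩
      exact ⟨⟨l, hl⟩, hn, rfl⟩
    · rintro ⟨l, hn, rfl⟩
      exact ⟨l.2, hn⟩
  rw [schurC, himage, Set.ncard_image_of_injective _ Subtype.val_injective]
  rfl

end SchurPartitions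

/-- Andrews' identity:
`𝒞_{3,1}(q) = ((-q;q)_∞ / (q^6;q^6)_∞) ·
Σ_{n≥0} (-1)^n q^{9n(n+1)/2} (1 - q^{6n+3}) / ((1+q^{3n+1})(1+q^{3n+2}))`. -/
theorem andrews_C31 (q : ℂ) (hq : ‖q‖ < 1) :
    schurCGen 3 1 q =
      qPochInf (-q) q / qPochInf (q ^ 6) (q ^ 6) *
        ∑' n : ℕ, (-1) ^ n * q ^ (9 * n * (n + 1) / 2) * (1 - q ^ (6 * n + 3)) /
          ((1 + q ^ (3 * n + 1)) * (1 + q ^ (3 * n + 2))) := by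
  have hp : ‖q ^ 3‖ < 1 := norm_pow_lt_one hq (by norm_num)
  have hb : ‖q ^ 2‖ < 1 := norm_pow_lt_one hq (by norm_num)
  have hlim : Tendsto (fun m : ℕ => schurSetGen q (3 * m + 4)) atTop (𝓝 1) :=
    (tendsto_schurSetGen hq).comp
      (tendsto_atTop_mono (fun m => show m ≤ 3 * m + 4 by omega) tendsto_id)
  have hsum := eq_watsonSum_of_recurrence hp hq hb (by ring) hlim
    (fun m => schurSetGen_recurrence hq m) 0
  rw [schurCGen_eq_schurSetGen hq, show (4 : ℕ) = 3 * 0 + 4 from rfl, hsum,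
    watsonSum_zero hp hq hb]
  have h6 : qPochInf (q ^ 6) (q ^ 6) =
      qPochInf (-q ^ 3) (q ^ 3) * qPochInf (q ^ 3) (q ^ 3) := by
    rw [qPochInf_neg_mul_self hp, ← pow_mul]
  have hP := qPochInf_ne_zero hp hp
  have hN := qPochInf_ne_zero hp (c := -q ^ 3) (by rwa [norm_neg])
  congr 1
  · rw [h6, qPochInf_trisection hq]
    field_simp
  · refine tsum_congr fun n => ?_
    have hexp : 9 * n * (n + 1) / 2 = 3 * (3 * (n * (n + 1) / 2)) := by
      obtain ⟨k, hk⟩ := (Nat.even_mul_succ_self n).two_dvd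
      rw [mul_assoc 9, hk]
      omega
    rw [hexp, pow_mul q 3]
    congr 2 <;> ring
end
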